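/- Under the PCL model with common price p across products, the total expected revenue R(p, x) = Σ_{i<j} V_ij^{γ_ij}(p,x)·R_ij(p,x) / (1 + Σ_{i<j} V_ij^{γ_ij}(p,x)) equals p·A(x)·e^{−βp}/(1 + A(x)·e^{−βp}), where A(x) = Σ_{i<j} (exp(α_i/γ_ij) x_i + exp(α_j/γ_ij) x_j)^{γ_ij}. -/

import Mathlib

open Finset

/-- In a nest with preference weights `exp (a - s)` and `exp (b - s)`, a common shift `s` factors out
of the nest attractiveness as `exp (-s)`. -/
theorem nest_rpow_eq_mul_exp_neg {a b s g y z : ℝ} (hg : 0 < g) (hy : 0 ≤ y) (hz : 0 ≤ z) :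
    ((Real.exp (a - s)) ^ (1 / g) * y + (Real.exp (b - s)) ^ (1 / g) * z) ^ g
      = (Real.exp (a / g) * y + Real.exp (b / g) * z) ^ g * Real.exp (-s) := by
  have hexp (c : ℝ) : (Real.exp (c - s)) ^ (1 / g) = Real.exp (c / g) * Real.exp (-s / g) := by
    rw [← Real.exp_mul, ← Real.exp_add]
    congr 1
    ring
  have hfactor : Real.exp (a / g) * Real.exp (-s / g) * y + Real.exp (b / g) * Real.exp (-s / g) * z
      = (Real.exp (a / g) * y + Real.exp (b / g) * z) * Real.exp (-s / g) := by ring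
  rw [hexp, hexp, hfactor, Real.mul_rpow (by positivity) (by positivity), ← Real.exp_mul,
    div_mul_cancel₀ _ hg.ne']

/-- The choice shares within a nest sum to one, unless the nest is empty and has attractiveness
zero. -/
theorem rpow_mul_shares_eq {g : ℝ} (hg : 0 < g) (p u w : ℝ) :
    (u + w) ^ g * (p * (u / (u + w) + w / (u + w))) = p * (u + w) ^ g := by
  rw [← add_div]
  rcases eq_or_ne (u + w) 0 with h | h
  · simp [h, Real.zero_rpow hg.ne']
  · rw [div_self h]
    ring

/-- Under the PCL model with common price p across products, the expected
revenue R(p,x) = Σ_{i<j} V_ij^{γ_ij} R_ij / (1 + Σ_{i<j} V_ij^{γ_ij}) equals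
p·A(x)·e^{−βp}/(1 + A(x)·e^{−βp}), where
A(x) = Σ_{i<j} (exp(α_i/γ_ij) x_i + exp(α_j/γ_ij) x_j)^{γ_ij},
V_ij = v_i^{1/γ_ij} x_i + v_j^{1/γ_ij} x_j with v_i = exp(α_i − βp),
R_ij = p·(q_i^{ij} + q_j^{ij}), q_i^{ij} = v_i^{1/γ_ij} x_i / V_ij (0 when V_ij = 0,
which is Lean's division-by-zero convention), and at least one x_i = 1. -/
theorem stmt10 (n : ℕ) (α : Fin n → ℝ) (γ : Fin n → Fin n → ℝ)
    (β p : ℝ) (hβ : 0 < β) (x : Fin n → ℝ)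
    (hx : ∀ i, x i = 0 ∨ x i = 1) (hone : ∃ i, x i = 1)
    (hγ : ∀ i j : Fin n, i < j → 0 < γ i j ∧ γ i j ≤ 1) :
    (∑ i, ∑ j, if i < j then
        ((Real.exp (α i - β * p)) ^ (1 / γ i j) * x i
          + (Real.exp (α j - β * p)) ^ (1 / γ i j) * x j) ^ γ i j
        * (p * ((Real.exp (α i - β * p)) ^ (1 / γ i j) * x i /
              ((Real.exp (α i - β * p)) ^ (1 / γ i j) * x i
                + (Real.exp (α j - β * p)) ^ (1 / γ i j) * x j)
            + (Real.exp (α j - β * p)) ^ (1 / γ i j) * x j /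
              ((Real.exp (α i - β * p)) ^ (1 / γ i j) * x i
                + (Real.exp (α j - β * p)) ^ (1 / γ i j) * x j)))
      else 0)
    / (1 + ∑ i, ∑ j, if i < j then
        ((Real.exp (α i - β * p)) ^ (1 / γ i j) * x i
          + (Real.exp (α j - β * p)) ^ (1 / γ i j) * x j) ^ γ i j else 0)
    = p * (∑ i, ∑ j, if i < j then
          (Real.exp (α i / γ i j) * x i + Real.exp (α j / γ i j) * x j) ^ γ i j else 0)
        * Real.exp (-β * p)
      / (1 + (∑ i, ∑ j, if i < j then
          (Real.exp (α i / γ i j) * x i + Real.exp (α j / γ i j) * x j) ^ γ i j else 0)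
        * Real.exp (-β * p)) := by
  have hx0 (i : Fin n) : 0 ≤ x i := by rcases hx i with h | h <;> simp [h]
  have hrev (i j : Fin n) (h : i < j) := rpow_mul_shares_eq (hγ i j h).1 p
    ((Real.exp (α i - β * p)) ^ (1 / γ i j) * x i) ((Real.exp (α j - β * p)) ^ (1 / γ i j) * x j)
  have hnest (i j : Fin n) (h : i < j) := nest_rpow_eq_mul_exp_neg (a := α i) (b := α j)
    (s := β * p) (hγ i j h).1 (hx0 i) (hx0 j)
  rw [mul_assoc]
  simp only [Finset.sum_mul, Finset.mul_sum, neg_mul]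
  congr 1
  · refine Finset.sum_congr rfl fun i _ => Finset.sum_congr rfl fun j _ => ?_
    split_ifs with h
    · rw [hrev i j h, hnest i j h]
    · simp
  · congr 1
    refine Finset.sum_congr rfl fun i _ => Finset.sum_congr rfl fun j _ => ?_
    split_ifs with h
    · rw [hnest i j h]
    · simp
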